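/- Kinetic interpolation inequalities (Corollary 1.6). Let d ≥ 1, α ∈ (0,1), T ∈ (−∞,∞]. Then there exists N = N(d,α) > 0 such that for every u ∈ kC^{2,α}(ℝ^{1+2d}_T) one has D_v u ∈ kC^α(ℝ^{1+2d}_T), and for every ε > 0 (all norms/seminorms over ℝ^{1+2d}_T): [u]_{kC^α} ≤ N ε² ( [∂_t u − v·D_x u]_{L∞C^{α/3,α}_{x,v}} + [D²_v u]_{L∞C^{α/3,α}_{x,v}} ) + N ε^{2−α} ‖∂_t u − v·D_x u‖_{L∞} + N ε^{−α} ‖u‖_{L∞}, and [D_v u]_{kC^α} ≤ N ε ( [∂_t u − v·D_x u]_{L∞C^{α/3,α}_{x,v}} + [D²_v u]_{L∞C^{α/3,α}_{x,v}} ) + N ε^{1−α} ‖∂_t u − v·D_x u‖_{L∞} + N ε^{−1−α} ‖u‖_{L∞}. -/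

import Mathlib

open MeasureTheory ENNReal Set

noncomputable section

/-- Euclidean space `ℝ^d`. -/
abbrev Ed (d : ℕ) : Type := EuclideanSpace ℝ (Fin d)

/-- Points `z = (t, x, v) ∈ ℝ × ℝ^d × ℝ^d`. -/
abbrev Pt (d : ℕ) : Type := ℝ × Ed d × Ed d

/-- The kinetic quasi-distance `ρ(z, z₀)`. -/
def kRho {d : ℕ} (z z0 : Pt d) : ℝ :=
  max (|z.1 - z0.1| ^ ((1 : ℝ)/2))
    (max (‖z.2.1 - z0.2.1 + (z.1 - z0.1) • z0.2.2‖ ^ ((1 : ℝ)/3)) ‖z.2.2 - z0.2.2‖)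

/-- The kinetic Hölder seminorm `[u]_{kC^α(G)}` (extended-real valued). -/
def kSemi {d : ℕ} {F : Type*} [NormedAddCommGroup F] (α : ℝ) (G : Set (Pt d))
    (u : Pt d → F) : ℝ≥0∞ :=
  ⨆ (z : Pt d) (_ : z ∈ G) (z' : Pt d) (_ : z' ∈ G) (_ : z ≠ z'),
    ENNReal.ofReal (‖u z - u z'‖ / kRho z z' ^ α)

/-- The sup (`L_∞`) norm over `G`, extended-real valued. -/
def supNorm {d : ℕ} {F : Type*} [NormedAddCommGroup F] (G : Set (Pt d))
    (u : Pt d → F) : ℝ≥0∞ :=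
  ⨆ (z : Pt d) (_ : z ∈ G), (‖u z‖₊ : ℝ≥0∞)

/-- Anisotropic Hölder seminorm `[w]_{C^{α/3,α}_{x,v}(D)}`. -/
def anisoSemi {d : ℕ} {F : Type*} [NormedAddCommGroup F] (α : ℝ) (D : Set (Ed d × Ed d))
    (w : Ed d × Ed d → F) : ℝ≥0∞ :=
  ⨆ (p : Ed d × Ed d) (_ : p ∈ D) (q : Ed d × Ed d) (_ : q ∈ D) (_ : p ≠ q),
    ENNReal.ofReal (‖w p - w q‖ / (‖p.1 - q.1‖ ^ ((1 : ℝ)/3) + ‖p.2 - q.2‖) ^ α)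

/-- The `L_∞ C^{α/3,α}_{x,v}` seminorm over `I × D`. -/
def lixvSemi {d : ℕ} {F : Type*} [NormedAddCommGroup F] (α : ℝ) (I : Set ℝ)
    (D : Set (Ed d × Ed d)) (u : Pt d → F) : ℝ≥0∞ :=
  ⨆ (t : ℝ) (_ : t ∈ I), anisoSemi α D (fun p => u (t, p.1, p.2))

/-- The time interval `(−∞, T)` for `T ∈ (−∞, ∞]`. -/
def slabI (T : EReal) : Set ℝ := {t : ℝ | (t : EReal) < T}

/-- The set `ℝ^{1+2d}_T = (−∞,T) × ℝ^{2d}`. -/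
def slabG (d : ℕ) (T : EReal) : Set (Pt d) := slabI T ×ˢ (Set.univ : Set (Ed d × Ed d))

/-- Classical time derivative `∂_t u`. -/
def Dt {d : ℕ} (u : Pt d → ℝ) (z : Pt d) : ℝ := deriv (fun s => u (s, z.2.1, z.2.2)) z.1

/-- Classical spatial gradient `D_x u`. -/
def Dx {d : ℕ} (u : Pt d → ℝ) (z : Pt d) : Ed d →L[ℝ] ℝ :=
  fderiv ℝ (fun y => u (z.1, y, z.2.2)) z.2.1

/-- Classical velocity gradient `D_v u`. -/
def Dv {d : ℕ} (u : Pt d → ℝ) (z : Pt d) : Ed d →L[ℝ] ℝ :=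
  fderiv ℝ (fun w => u (z.1, z.2.1, w)) z.2.2

/-- Classical velocity Hessian `D²_v u`. -/
def Dvv {d : ℕ} (u : Pt d → ℝ) (z : Pt d) : Ed d →L[ℝ] Ed d →L[ℝ] ℝ :=
  fderiv ℝ (fun w => Dv u (z.1, z.2.1, w)) z.2.2

/-- Transport term `Y u = ∂_t u − v · D_x u`. -/
def Yop {d : ℕ} (u : Pt d → ℝ) (z : Pt d) : ℝ := Dt u z - Dx u z z.2.2

/-- Contraction `a^{ij} B_{ij}`. -/
def contr2 {d : ℕ} (A : Matrix (Fin d) (Fin d) ℝ) (B : Ed d →L[ℝ] Ed d →L[ℝ] ℝ) : ℝ :=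
  ∑ i, ∑ j, A i j * B (EuclideanSpace.single i 1) (EuclideanSpace.single j 1)

/-- KFP operator `P u = ∂_t u − v·D_x u − a^{ij}(z) D_{v_iv_j} u`. -/
def Pop {d : ℕ} (a : Pt d → Matrix (Fin d) (Fin d) ℝ) (u : Pt d → ℝ) (z : Pt d) : ℝ :=
  Yop u z - contr2 (a z) (Dvv u z)

/-- Model KFP operator with `a = a(t)`. -/
def P0op {d : ℕ} (a : ℝ → Matrix (Fin d) (Fin d) ℝ) (u : Pt d → ℝ) (z : Pt d) : ℝ :=
  Yop u z - contr2 (a z.1) (Dvv u z)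

/-- Laplacian in the velocity variable `Δ_v u`. -/
def lapV {d : ℕ} (u : Pt d → ℝ) (z : Pt d) : ℝ :=
  ∑ i, Dvv u z (EuclideanSpace.single i 1) (EuclideanSpace.single i 1)

/-- Fractional Laplacian `(−Δ_x)^{1/3} u`, pointwise integral formula with constant `cd`. -/
def fracLap {d : ℕ} (cd : ℝ) (u : Pt d → ℝ) (z : Pt d) : ℝ :=
  cd * ∫ y : Ed d, (u z - u (z.1, z.2.1 + y, z.2.2)) / ‖y‖ ^ ((d : ℝ) + 2/3)

/-- Hölder seminorm in `x` of a function on `ℝ^d`. -/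
def xSemi {d : ℕ} (β : ℝ) (w : Ed d → ℝ) : ℝ≥0∞ :=
  ⨆ (x : Ed d) (x' : Ed d) (_ : x ≠ x'), ENNReal.ofReal (|w x - w x'| / ‖x - x'‖ ^ β)

/-- `sup_{t ∈ I, v} [u(t,·,v)]_{C^β(ℝ^d)}`. -/
def supXSemi {d : ℕ} (β : ℝ) (I : Set ℝ) (u : Pt d → ℝ) : ℝ≥0∞ :=
  ⨆ (t : ℝ) (_ : t ∈ I) (v : Ed d), xSemi β (fun x => u (t, x, v))

/-- Hölder norm in `x` over a set `A ⊂ ℝ^d`. -/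
def xHolderNorm {d : ℕ} (β : ℝ) (A : Set (Ed d)) (w : Ed d → ℝ) : ℝ≥0∞ :=
  (⨆ (x : Ed d) (_ : x ∈ A), ENNReal.ofReal |w x|) +
    ⨆ (x : Ed d) (_ : x ∈ A) (x' : Ed d) (_ : x' ∈ A) (_ : x ≠ x'),
      ENNReal.ofReal (|w x - w x'| / ‖x - x'‖ ^ β)

/-- Kinetic cylinder `Q_{r,s}(z₀)` (`v`-radius `r`, `x`-radius `s³`). -/
def kCyl {d : ℕ} (r s : ℝ) (z0 : Pt d) : Set (Pt d) :=
  {z : Pt d | z0.1 - r ^ 2 < z.1 ∧ z.1 < z0.1 ∧ ‖z.2.2 - z0.2.2‖ < r ∧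
    ‖z.2.1 - z0.2.1 + (z.1 - z0.1) • z0.2.2‖ < s ^ 3}

/-- Kinetic cylinder `Q_r(z₀)`. -/
def kQ {d : ℕ} (r : ℝ) (z0 : Pt d) : Set (Pt d) := kCyl r r z0

/-- The origin of `ℝ^{1+2d}`. -/
def ptO (d : ℕ) : Pt d := (0, 0, 0)

/-- Mean-square average `(|g|²)^{1/2}_A`. -/
def msq {d : ℕ} {F : Type*} [NormedAddCommGroup F] (A : Set (Pt d)) (g : Pt d → F) : ℝ :=
  Real.sqrt (⨍ z in A, ‖g z‖ ^ 2)

/-- Average `(g)_A`. -/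
def avg {d : ℕ} {F : Type*} [NormedAddCommGroup F] [NormedSpace ℝ F] (A : Set (Pt d))
    (g : Pt d → F) : F :=
  ⨍ z in A, g z

/-- Mean-square oscillation `(|g − (g)_A|²)^{1/2}_A`. -/
def oscL2 {d : ℕ} {F : Type*} [NormedAddCommGroup F] [NormedSpace ℝ F] (A : Set (Pt d))
    (g : Pt d → F) : ℝ :=
  msq A (fun z => g z - avg A g)

/-- `L²` norm over `A`. -/
def l2 {d : ℕ} {F : Type*} [NormedAddCommGroup F] (A : Set (Pt d)) (g : Pt d → F) : ℝ :=
  Real.sqrt (∫ z in A, ‖g z‖ ^ 2)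

/-- Membership in the kinetic Hölder space `kC^{2,α}(I × D)`:
`u ∈ kC^α`, the classical derivatives `D_v u`, `D²_v u`, `Y u` exist,
`Y u ∈ L_∞ C^{α/3,α}_{x,v}` and `[D²_v u]_{kC^α} < ∞`. -/
def kC2mem {d : ℕ} (α : ℝ) (I : Set ℝ) (D : Set (Ed d × Ed d)) (u : Pt d → ℝ) : Prop :=
  supNorm (I ×ˢ D) u < ⊤ ∧ kSemi α (I ×ˢ D) u < ⊤ ∧
  (∀ z ∈ I ×ˢ D, DifferentiableAt ℝ (fun s => u (s, z.2.1, z.2.2)) z.1) ∧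
  (∀ z ∈ I ×ˢ D, DifferentiableAt ℝ (fun y => u (z.1, y, z.2.2)) z.2.1) ∧
  (∀ z ∈ I ×ˢ D, DifferentiableAt ℝ (fun w => u (z.1, z.2.1, w)) z.2.2) ∧
  (∀ z ∈ I ×ˢ D, DifferentiableAt ℝ (fun w => Dv u (z.1, z.2.1, w)) z.2.2) ∧
  supNorm (I ×ˢ D) (Yop u) < ⊤ ∧
  lixvSemi α I D (Yop u) < ⊤ ∧
  kSemi α (I ×ˢ D) (Dvv u) < ⊤

/-- Membership in the anisotropic Hölder space `ℂ^{2,α}(I × D)`: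
the classical derivatives `D_v u`, `D²_v u`, `Y u` exist and
`u, D_v u, D²_v u, Y u ∈ L_∞ C^{α/3,α}_{x,v}(I × D)`. -/
def C2mem {d : ℕ} (α : ℝ) (I : Set ℝ) (D : Set (Ed d × Ed d)) (u : Pt d → ℝ) : Prop :=
  (∀ z ∈ I ×ˢ D, DifferentiableAt ℝ (fun s => u (s, z.2.1, z.2.2)) z.1) ∧
  (∀ z ∈ I ×ˢ D, DifferentiableAt ℝ (fun y => u (z.1, y, z.2.2)) z.2.1) ∧
  (∀ z ∈ I ×ˢ D, DifferentiableAt ℝ (fun w => u (z.1, z.2.1, w)) z.2.2) ∧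
  (∀ z ∈ I ×ˢ D, DifferentiableAt ℝ (fun w => Dv u (z.1, z.2.1, w)) z.2.2) ∧
  supNorm (I ×ˢ D) u < ⊤ ∧ lixvSemi α I D u < ⊤ ∧
  supNorm (I ×ˢ D) (Dv u) < ⊤ ∧ lixvSemi α I D (Dv u) < ⊤ ∧
  supNorm (I ×ˢ D) (Dvv u) < ⊤ ∧ lixvSemi α I D (Dvv u) < ⊤ ∧
  supNorm (I ×ˢ D) (Yop u) < ⊤ ∧ lixvSemi α I D (Yop u) < ⊤

/-- Ellipticity and boundedness of a coefficient matrix: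
`a^{ij} ξ_i ξ_j ≥ δ|ξ|²` and `|a| ≤ δ⁻¹`. -/
def elliptic {d : ℕ} (δ : ℝ) (A : Matrix (Fin d) (Fin d) ℝ) : Prop :=
  (∀ ξ : Ed d, δ * ‖ξ‖ ^ 2 ≤ ∑ i, ∑ j, A i j * ξ i * ξ j) ∧ (∀ i j, |A i j| ≤ δ⁻¹)

/-- Iterated classical mixed derivative `D_v^m D_x^l u`. -/
def Dmix {d : ℕ} (l m : ℕ) (u : Pt d → ℝ) (z : Pt d) :
    ContinuousMultilinearMap ℝ (fun _ : Fin m => Ed d)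
      (ContinuousMultilinearMap ℝ (fun _ : Fin l => Ed d) ℝ) :=
  iteratedFDeriv ℝ m (fun w => iteratedFDeriv ℝ l (fun y => u (z.1, y, w)) z.2.1) z.2.2

/-- Time derivative of the mixed derivative: `∂_t D_x^l D_v^m u`. -/
def DtMix {d : ℕ} (l m : ℕ) (u : Pt d → ℝ) (z : Pt d) :
    ContinuousMultilinearMap ℝ (fun _ : Fin m => Ed d)
      (ContinuousMultilinearMap ℝ (fun _ : Fin l => Ed d) ℝ) :=
  deriv (fun s => Dmix l m u (s, z.2.1, z.2.2)) z.1

/-- `∂_t` for functions of `(t,v)`. -/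
def Dt2 {d : ℕ} (w : ℝ × Ed d → ℝ) (t : ℝ) (v : Ed d) : ℝ := deriv (fun s => w (s, v)) t

/-- `D_v` for functions of `(t,v)`. -/
def Dv2 {d : ℕ} (w : ℝ × Ed d → ℝ) (t : ℝ) (v : Ed d) : Ed d →L[ℝ] ℝ :=
  fderiv ℝ (fun y => w (t, y)) v

/-- `D²_v` for functions of `(t,v)`. -/
def Dvv2 {d : ℕ} (w : ℝ × Ed d → ℝ) (t : ℝ) (v : Ed d) : Ed d →L[ℝ] Ed d →L[ℝ] ℝ :=
  fderiv ℝ (fun y => Dv2 w t y) v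

/-- The kinetic scaling `z ↦ z̃ = (r²t + t₀, r³x + x₀ − r²t v₀, rv + v₀)`. -/
def kScale {d : ℕ} (r : ℝ) (z0 z : Pt d) : Pt d :=
  (r ^ 2 * z.1 + z0.1, (r ^ 3) • z.2.1 + z0.2.1 - (r ^ 2 * z.1) • z0.2.2, r • z.2.2 + z0.2.2)

/-- Kinetic Campanato seminorm. -/
def campSemi {d : ℕ} (α : ℝ) (T : EReal) (u : Pt d → ℝ) : ℝ≥0∞ :=
  ⨆ (r : ℝ) (_ : 0 < r) (z0 : Pt d) (_ : (z0.1 : EReal) ≤ T),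
    ENNReal.ofReal (oscL2 (kQ r z0) u / r ^ α)

end

section KineticInterpolation

open Filter Topology

/-- A continuous function whose right lower slopes are at most `c` off a countable set has increments
at most `c` times the length. -/
theorem sub_le_mul_of_frequently_slope_le {φ : ℝ → ℝ} {a b c : ℝ} (hab : a ≤ b)
    (hφ : ContinuousOn φ (Icc a b)) {S : Set ℝ} (hS : S.Countable)
    (h : ∀ s ∈ Ico a b, s ∉ S → ∃ᶠ s' in 𝓝[>] s, φ s' - φ s ≤ c * (s' - s)) :
    φ b - φ a ≤ c * (b - a) := by
  rcases hab.eq_or_lt with rfl | hab'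
  · simp
  by_contra! hlt
  obtain ⟨c', hc', hc'2⟩ : ∃ c', c < c' ∧ c' * (b - a) < φ b - φ a := by
    have hpos : 0 < b - a := sub_pos.2 hab'
    obtain ⟨c', h1, h2⟩ := exists_between ((lt_div_iff₀ hpos).2 hlt)
    exact ⟨c', h1, (lt_div_iff₀ hpos).1 h2⟩
  set ψ : ℝ → ℝ := fun x => φ x - c' * x with hψ
  have hψc : ContinuousOn ψ (Icc a b) := hφ.sub (by fun_prop)
  have hψab : ψ a < ψ b := by simp only [hψ]; linarith
  have hsub : Ioo (ψ a) (ψ b) ⊆ ψ '' S := by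
    rintro y ⟨hya, hyb⟩
    have hcpt : IsCompact (Icc a b ∩ ψ ⁻¹' Iic y) :=
      isCompact_Icc.of_isClosed_subset (hψc.preimage_isClosed_of_isClosed isClosed_Icc isClosed_Iic)
        inter_subset_left
    obtain ⟨x, ⟨⟨hxI, hxy⟩, hmax⟩⟩ :=
      hcpt.exists_isGreatest ⟨a, ⟨le_rfl, hab⟩, hya.le⟩
    have hxy' : ψ x ≤ y := hxy
    have hxb : x < b := lt_of_le_of_ne hxI.2 (by rintro rfl; linarith)
    obtain ⟨x', hx', hx'y⟩ := intermediate_value_Icc hxI.2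
      (hψc.mono (Icc_subset_Icc_left hxI.1)) ⟨hxy', hyb.le⟩
    have hxx' : x' = x := le_antisymm
      (hmax ⟨⟨hxI.1.trans hx'.1, hx'.2⟩, hx'y.le⟩) hx'.1
    subst hxx'
    refine ⟨x', ?_, hx'y⟩
    by_contra hxS
    obtain ⟨s, hs, hs1, hs2⟩ := ((h x' ⟨hxI.1, hxb⟩ hxS).and_eventually
      (Ioo_mem_nhdsGT hxb)).exists
    have : y < ψ s := by
      by_contra! hle
      exact absurd (hmax ⟨⟨hxI.1.trans hs1.le, hs2.le⟩, hle⟩) (not_le.2 hs1)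
    rw [← hx'y] at this
    simp only [hψ] at this
    nlinarith
  exact absurd (Cardinal.Real.Ioo_countable_iff.1 ((hS.image ψ).mono hsub)) (not_le.2 hψab)

/-- Diagonal increments of a separately differentiable function: no joint differentiability is
needed, only continuity on the diagonal. -/
theorem diag_sub_le_of_hasDerivAt {h : ℝ → ℝ → ℝ} {p q : ℝ → ℝ} {a b K : ℝ} (hab : a ≤ b)
    (hc : ContinuousOn (fun s => h s s) (Icc a b))
    (hp : ∀ s ∈ Ico a b, HasDerivAt (fun t => h t s) (p s) s)
    (hq : ∀ s ∈ Ico a b, HasDerivAt (fun y => h s y) (q s) s)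
    (hpq : ∀ s ∈ Ico a b, p s + q s ≤ K) :
    h b b - h a a ≤ K * (b - a) := by
  have key : ∀ δ > 0, h b b - h a a ≤ (K + 4 * δ) * (b - a) := by
    intro δ hδ
    let E : ℤ → ℕ → Set ℝ := fun j m => {s | ∀ τ : ℝ, |τ| < 1 / ((m : ℝ) + 1) →
      |h s (s + τ) - h s s - τ * (j * δ)| ≤ 2 * δ * |τ|}
    let S : Set ℝ := ⋃ j, ⋃ m, {s ∈ E j m | 𝓝[E j m ∩ Ioi s] s = ⊥}
    have hS : S.Countable := countable_iUnion fun j => countable_iUnion fun m =>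
      countable_setOfPred_isolated_right_within
    refine sub_le_mul_of_frequently_slope_le (φ := fun s => h s s) hab hc hS ?_
    intro s hs hsS
    set j : ℤ := ⌊q s / δ⌋ with hj
    have hj1 : j * δ ≤ q s := (le_div_iff₀ hδ).1 (Int.floor_le _)
    have hj2 : q s < (j + 1) * δ := (div_lt_iff₀ hδ).1 (Int.lt_floor_add_one _)
    obtain ⟨m, hm⟩ : ∃ m, s ∈ E j m := by
      have h1 := (hasDerivAt_iff_isLittleO_nhds_zero.1 (hq s hs)).def hδ
      obtain ⟨η, hη, hball⟩ := Metric.eventually_nhds_iff.1 h1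
      obtain ⟨m, hm⟩ := exists_nat_one_div_lt hη
      refine ⟨m, fun τ hτ => ?_⟩
      have h2 := hball (y := τ) (by simpa using hτ.trans hm)
      simp only [Real.norm_eq_abs, smul_eq_mul] at h2
      have h3 : |τ * (q s - j * δ)| ≤ δ * |τ| := by
        rw [abs_mul, mul_comm, abs_of_nonneg (by linarith)]
        gcongr; linarith
      calc |h s (s + τ) - h s s - τ * (j * δ)|
          = |(h s (s + τ) - h s s - τ * q s) + τ * (q s - j * δ)| := by ring_nf
        _ ≤ _ := abs_add_le _ _
        _ ≤ 2 * δ * |τ| := by linarith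
    have hne : (𝓝[E j m ∩ Ioi s] s).NeBot := by
      refine ⟨fun hbot => hsS ?_⟩
      exact mem_iUnion.2 ⟨j, mem_iUnion.2 ⟨m, hm, hbot⟩⟩
    have hfreq : ∃ᶠ s' in 𝓝[>] s, s' ∈ E j m := by
      rw [frequently_iff_neBot, ← nhdsWithin_inter', inter_comm]
      exact hne
    have hev1 : ∀ᶠ s' in 𝓝[>] s, |h s' s - h s s - (s' - s) * p s| ≤ δ * |s' - s| := by
      have := ((hp s hs).isLittleO).def hδ
      simpa using this.filter_mono nhdsWithin_le_nhds
    have hev2 : ∀ᶠ s' in 𝓝[>] s, s' < s + 1 / ((m : ℝ) + 1) := by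
      have hm1 : s < s + 1 / ((m : ℝ) + 1) := lt_add_of_pos_right _ (by positivity)
      filter_upwards [Ioo_mem_nhdsGT hm1] with x hx using hx.2
    refine (hfreq.and_eventually (hev1.and (hev2.and self_mem_nhdsWithin))).mono ?_
    rintro s' ⟨hE, h1, h2, h3⟩
    have h3' : s < s' := h3
    have habs : |s - s'| = s' - s := by rw [abs_sub_comm, abs_of_pos (by linarith)]
    have h4 := hE (s - s') (by rw [habs]; linarith)
    rw [habs, add_sub_cancel] at h4
    rw [abs_of_pos (show 0 < s' - s by linarith)] at h1
    have h5 := (abs_le.1 h4).1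
    have h6 := (abs_le.1 h1).2
    have h7 := hpq s hs
    have h8 : (s' - s) * (p s + j * δ) ≤ (s' - s) * K := by
      gcongr
      linarith
    show h s' s' - h s s ≤ _
    nlinarith
  have hlim : Tendsto (fun δ : ℝ => (K + 4 * δ) * (b - a)) (𝓝[>] 0) (𝓝 ((K + 4 * 0) * (b - a))) :=
    (Continuous.tendsto (by fun_prop) 0).mono_left nhdsWithin_le_nhds
  have := ge_of_tendsto hlim (eventually_nhdsWithin_of_forall key)
  simpa using this

theorem ContinuousLinearMap.norm_le_of_forall_norm_eq {d : ℕ} {ℓ : Ed d →L[ℝ] ℝ} {r c : ℝ} (hr : 0 < r) (hc : 0 ≤ c)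
    (h : ∀ e, ‖e‖ = r → |ℓ e| ≤ c * r) : ‖ℓ‖ ≤ c := by
  refine ℓ.opNorm_le_bound hc fun e => ?_
  rcases eq_or_ne e 0 with rfl | he
  · simp
  have hpos : 0 < ‖e‖ := norm_pos_iff.2 he
  have h1 := h ((r / ‖e‖) • e) (by
    rw [norm_smul, Real.norm_of_nonneg (by positivity), div_mul_cancel₀ _ hpos.ne'])
  rw [map_smul, smul_eq_mul, abs_mul, abs_of_pos (by positivity), div_mul_eq_mul_div,
    div_le_iff₀ hpos] at h1
  rw [Real.norm_eq_abs]
  nlinarith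

/-- Data extracted from `kC2mem`: a sup bound, a Lipschitz bound along the transport flow, and a
second-order Taylor bound in the velocity variable. -/
structure KineticBounds {d : ℕ} (I : Set ℝ) (u : Pt d → ℝ) (M K L : ℝ) : Prop where
  K_nonneg : 0 ≤ K
  L_nonneg : 0 ≤ L
  sub_mem : ∀ t ∈ I, ∀ s : ℝ, 0 ≤ s → t - s ∈ I
  abs_le : ∀ t ∈ I, ∀ x v, |u (t, x, v)| ≤ M
  flow : ∀ t ∈ I, ∀ t' ∈ I, ∀ x v, |u (t, x - (t - t') • v, v) - u (t', x, v)| ≤ K * |t - t'|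
  taylor : ∀ t ∈ I, ∀ x v e,
    |u (t, x, v + e) - u (t, x, v) - Dv u (t, x, v) e| ≤ L * ‖e‖ ^ 2

namespace KineticBounds

variable {d : ℕ} {I : Set ℝ} {u : Pt d → ℝ} {M K L : ℝ}

theorem second_diff_v (h : KineticBounds I u M K L) {t : ℝ} (ht : t ∈ I) (x v e : Ed d) :
    |u (t, x, v + e) + u (t, x, v - e) - 2 * u (t, x, v)| ≤ 2 * L * ‖e‖ ^ 2 := by
  have h1 := h.taylor t ht x v e
  have h2 := h.taylor t ht x v (-e)
  rw [norm_neg, map_neg, ← sub_eq_add_neg] at h2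
  rw [_root_.abs_le] at *
  constructor <;> linarith

/-- Second differences in the sheared directions `(-s w, w)`, obtained by transporting a second
difference in `v` from time `t - s`. -/
theorem second_diff_shear (h : KineticBounds I u M K L) {t : ℝ} (ht : t ∈ I) {s : ℝ} (hs : 0 ≤ s)
    (x v w : Ed d) :
    |u (t, x - s • w, v + w) + u (t, x + s • w, v - w) - 2 * u (t, x, v)|
      ≤ 4 * s * K + 2 * L * ‖w‖ ^ 2 := by
  have hts := h.sub_mem t ht s hs
  have h0 := h.second_diff_v hts (x + s • v) v w
  have hf := h.flow t ht (t - s) hts (x + s • v)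
  simp only [_root_.sub_sub_cancel, abs_of_nonneg hs] at hf
  have h1 := hf v
  have h2 := hf (v + w)
  have h3 := hf (v - w)
  rw [show x + s • v - s • v = x by abel] at h1
  rw [show x + s • v - s • (v + w) = x - s • w by rw [smul_add]; abel] at h2
  rw [show x + s • v - s • (v - w) = x + s • w by rw [smul_sub]; abel] at h3
  rw [_root_.abs_le] at *
  constructor <;> linarith

theorem second_diff_x (h : KineticBounds I u M K L) {t : ℝ} (ht : t ∈ I) {r : ℝ} (hr : 0 < r)
    (x v k : Ed d) (hk : ‖k‖ ≤ r ^ 3) :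
    |u (t, x + k, v) + u (t, x - k, v) - 2 * u (t, x, v)| ≤ 16 * (K + L) * r ^ 2 := by
  obtain ⟨w, hw, rfl⟩ : ∃ w : Ed d, ‖w‖ ≤ r ∧ k = (r ^ 2) • w := by
    refine ⟨(r ^ 2)⁻¹ • k, ?_, by rw [smul_inv_smul₀ (by positivity)]⟩
    rw [norm_smul, norm_inv, Real.norm_of_nonneg (by positivity), inv_mul_le_iff₀ (by positivity)]
    linarith [show r ^ 2 * r = r ^ 3 by ring]
  have hw2 : L * ‖w‖ ^ 2 ≤ L * r ^ 2 := by
    have := h.L_nonneg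
    gcongr
  have hKr : 0 ≤ K * r ^ 2 := mul_nonneg h.K_nonneg (by positivity)
  have hr2 : 0 ≤ r ^ 2 := by positivity
  have ha1 := h.second_diff_v ht (x - (r ^ 2) • w) (v + w) w
  have ha2 := h.second_diff_v ht (x + (r ^ 2) • w) (v - w) w
  have hb := h.second_diff_shear ht hr2 x v w
  have hab := h.second_diff_shear ht (half_pos (pow_pos hr 2)).le x v ((2 : ℝ) • w)
  rw [smul_smul, div_mul_cancel₀ _ (two_ne_zero), two_smul, ← add_assoc, ← sub_sub, ← two_smul ℝ,
    norm_smul, Real.norm_two, mul_pow] at hab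
  rw [add_sub_cancel_right] at ha1
  rw [sub_add_cancel] at ha2
  rw [_root_.abs_le] at *
  constructor <;> linarith

theorem diff_x_aux (h : KineticBounds I u M K L) {t : ℝ} (ht : t ∈ I) (n : ℕ) :
    ∀ {r : ℝ}, 0 < r → ∀ x v k : Ed d, ‖k‖ ≤ r ^ 3 →
      |u (t, x + k, v) - u (t, x, v)| ≤ 2 * M * (1 / 2) ^ n + 64 * (K + L) * r ^ 2 := by
  have hQ : 0 ≤ K + L := add_nonneg h.K_nonneg h.L_nonneg
  induction n with
  | zero =>
    intro r hr x v k hk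
    have h1 := h.abs_le t ht x v
    have h2 := h.abs_le t ht (x + k) v
    have h3 : 0 ≤ (K + L) * r ^ 2 := by positivity
    rw [_root_.abs_le] at *
    constructor <;> linarith
  | succ n ih =>
    intro r hr x v k hk
    have h1 := ih (r := 1.3 * r) (by positivity) x v (k + k) (by
      have := norm_add_le k k
      have h3 : 0 < r ^ 3 := by positivity
      have h4 : (1.3 * r) ^ 3 = 2.197 * r ^ 3 := by ring
      linarith)
    have h2 := h.second_diff_x ht hr (x + k) v k hk
    rw [add_sub_cancel_right, add_assoc] at h2
    have h3 : 0 ≤ (K + L) * r ^ 2 := by positivity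
    rw [pow_succ]
    rw [_root_.abs_le] at *
    constructor <;> nlinarith

theorem diff_x (h : KineticBounds I u M K L) {t : ℝ} (ht : t ∈ I) {r : ℝ} (hr : 0 < r)
    (x v k : Ed d) (hk : ‖k‖ ≤ r ^ 3) :
    |u (t, x + k, v) - u (t, x, v)| ≤ 64 * (K + L) * r ^ 2 := by
  have hlim : Tendsto (fun n : ℕ => 2 * M * (1 / 2) ^ n + 64 * (K + L) * r ^ 2) atTop
      (𝓝 (2 * M * 0 + 64 * (K + L) * r ^ 2)) :=
    ((_root_.tendsto_pow_atTop_nhds_zero_of_lt_one (by norm_num) (by norm_num)).const_mul _).add_const _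
  have := ge_of_tendsto' hlim fun n => h.diff_x_aux ht n hr x v k hk
  simpa using this

theorem diff_tx (h : KineticBounds I u M K L) {t t' : ℝ} (ht : t ∈ I) (ht' : t' ∈ I) {r ρ : ℝ}
    (hr : 0 < r) (x x' v : Ed d) (hx : ‖x - x' + (t - t') • v‖ ≤ r ^ 3) (hρ : |t - t'| ≤ ρ ^ 2) :
    |u (t, x, v) - u (t', x', v)| ≤ 64 * (K + L) * r ^ 2 + K * ρ ^ 2 := by
  have h1 := h.diff_x ht hr (x' - (t - t') • v) v _ hx
  have h2 := h.flow t ht t' ht' x' v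
  rw [show x' - (t - t') • v + (x - x' + (t - t') • v) = x by abel] at h1
  have h3 : K * |t - t'| ≤ K * ρ ^ 2 := mul_le_mul_of_nonneg_left hρ h.K_nonneg
  have h4 := abs_sub_le (u (t, x, v)) (u (t, x' - (t - t') • v, v)) (u (t', x', v))
  linarith

theorem norm_Dv_le (h : KineticBounds I u M K L) {t : ℝ} (ht : t ∈ I) {r : ℝ} (hr : 0 < r)
    (x v : Ed d) : ‖Dv u (t, x, v)‖ ≤ L * r + 2 * M / r := by
  have hM : 0 ≤ M := (abs_nonneg _).trans (h.abs_le t ht x v)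
  have hL := h.L_nonneg
  refine ContinuousLinearMap.norm_le_of_forall_norm_eq hr (by positivity) fun e he => ?_
  have h1 := h.taylor t ht x v e
  have h2 := h.abs_le t ht x v
  have h3 := h.abs_le t ht x (v + e)
  rw [he] at h1
  rw [show (L * r + 2 * M / r) * r = L * r ^ 2 + 2 * M by field_simp]
  rw [_root_.abs_le] at *
  constructor <;> linarith

theorem norm_Dv_sub_v (h : KineticBounds I u M K L) {t : ℝ} (ht : t ∈ I) {r : ℝ} (hr : 0 < r)
    (x v v' : Ed d) (hv : ‖v - v'‖ ≤ r) : ‖Dv u (t, x, v) - Dv u (t, x, v')‖ ≤ 6 * L * r := by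
  have hL := h.L_nonneg
  refine ContinuousLinearMap.norm_le_of_forall_norm_eq hr (by positivity) fun e he => ?_
  have h1 := h.taylor t ht x v e
  have h2 := h.taylor t ht x v' (v - v' + e)
  have h3 := h.taylor t ht x v' (v - v')
  rw [← add_assoc, add_sub_cancel, map_add] at h2
  rw [add_sub_cancel] at h3
  rw [he] at h1
  have h4 : L * ‖v - v' + e‖ ^ 2 ≤ L * (2 * r) ^ 2 := by
    gcongr
    linarith [norm_add_le (v - v') e]
  have h5 : L * ‖v - v'‖ ^ 2 ≤ L * r ^ 2 := by gcongr
  rw [_root_.sub_apply]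
  rw [_root_.abs_le] at *
  constructor <;> linarith

theorem norm_Dv_sub_tx (h : KineticBounds I u M K L) {t t' : ℝ} (ht : t ∈ I) (ht' : t' ∈ I)
    {r : ℝ} (hr : 0 < r) (x x' v : Ed d) (hx : ‖x - x' + (t - t') • v‖ ≤ r ^ 3)
    (ht2 : |t - t'| ≤ r ^ 2) :
    ‖Dv u (t, x, v) - Dv u (t', x', v)‖ ≤ 180 * (K + L) * r := by
  have hL := h.L_nonneg
  have hK := h.K_nonneg
  refine ContinuousLinearMap.norm_le_of_forall_norm_eq hr (by positivity) fun e he => ?_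
  have h1 := h.taylor t ht x v e
  have h2 := h.taylor t' ht' x' v e
  have h3 := h.diff_tx ht ht' hr x x' v hx ht2
  have h4 := h.diff_tx ht ht' (r := 1.3 * r) (by positivity) x x' (v + e) (by
    rw [smul_add, ← add_assoc]
    have h5 := norm_add_le (x - x' + (t - t') • v) ((t - t') • e)
    rw [norm_smul, Real.norm_eq_abs, he] at h5
    have h6 : |t - t'| * r ≤ r ^ 2 * r := by gcongr
    have h7 : 0 < r ^ 3 := by positivity
    have h8 : (1.3 * r) ^ 3 = 2.197 * r ^ 3 := by ring
    linarith [show r ^ 2 * r = r ^ 3 by ring]) ht2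
  rw [he] at h1 h2
  have h9 : 0 ≤ K * r ^ 2 := by positivity
  have h10 : 0 ≤ L * r ^ 2 := by positivity
  rw [_root_.sub_apply]
  rw [_root_.abs_le] at *
  constructor <;> nlinarith

end KineticBounds

section Taylor

variable {V : Type*} [NormedAddCommGroup V] [NormedSpace ℝ V] {f : V → ℝ} {f' : V → V →L[ℝ] ℝ}
  {f'' : V → V →L[ℝ] V →L[ℝ] ℝ}

theorem abs_taylor_two_sub_le (hf : ∀ w, HasFDerivAt f (f' w) w)
    (hf' : ∀ w, HasFDerivAt f' (f'' w) w) {v e : V} {q b : ℝ}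
    (hb : ∀ s ∈ Icc (0 : ℝ) 1, |f'' (v + s • e) e e - q| ≤ b) :
    |f (v + e) - f v - f' v e - q / 2| ≤ b := by
  have hline : ∀ s : ℝ, HasDerivAt (fun s : ℝ => v + s • e) e s := fun s => by
    simpa using ((hasDerivAt_id s).smul_const e).const_add v
  have h1 : ∀ s : ℝ, HasDerivAt (fun s : ℝ => f (v + s • e)) (f' (v + s • e) e) s := fun s =>
    (hf _).comp_hasDerivAt s (hline s)
  have h2 : ∀ s : ℝ, HasDerivAt (fun s : ℝ => f' (v + s • e) e) (f'' (v + s • e) e e) s :=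
    fun s => by
      simpa using ((hf' _).comp_hasDerivAt s (hline s)).clm_apply (hasDerivAt_const s e)
  have hb0 : 0 ≤ b := (abs_nonneg _).trans (hb 0 (by simp))
  have h3 : ∀ s ∈ Icc (0 : ℝ) 1, |f' (v + s • e) e - s * q - f' v e| ≤ b := by
    intro s hs
    have h4 := norm_image_sub_le_of_norm_deriv_le_segment'
      (f := fun s : ℝ => f' (v + s • e) e - s * q) (f' := fun s => f'' (v + s • e) e e - 1 * q)
      (a := 0) (b := 1) (C := b)
      (fun s _ => ((h2 s).sub ((hasDerivAt_id s).mul_const q)).hasDerivWithinAt)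
      (fun s hs => by simpa using hb s (Ico_subset_Icc_self hs)) s hs
    simp only [Real.norm_eq_abs, zero_smul, add_zero, zero_mul, sub_zero] at h4
    exact h4.trans (mul_le_of_le_one_right hb0 hs.2)
  have h5 := norm_image_sub_le_of_norm_deriv_le_segment_01'
    (f := fun s : ℝ => f (v + s • e) - s ^ 2 * (q / 2) - s * f' v e)
    (f' := fun s => f' (v + s • e) e - (2 * s) * (q / 2) - 1 * f' v e) (C := b)
    (fun s _ => (((h1 s).sub (by simpa using (hasDerivAt_pow 2 s).mul_const (q / 2))).sub
      ((hasDerivAt_id s).mul_const _)).hasDerivWithinAt)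
    (fun s hs => by
      have := h3 s (Ico_subset_Icc_self hs)
      rw [Real.norm_eq_abs]
      convert this using 2
      ring)
  simp only [Real.norm_eq_abs, one_smul, zero_smul, add_zero] at h5
  convert h5 using 2
  ring

theorem abs_hessian_apply_le (hf : ∀ w, HasFDerivAt f (f' w) w)
    (hf' : ∀ w, HasFDerivAt f' (f'' w) w) {M A α r : ℝ} (hα : 0 ≤ α) (hA : 0 ≤ A) (hr : 0 < r)
    (hM : ∀ w, |f w| ≤ M) (hH : ∀ w w', ‖f'' w - f'' w'‖ ≤ A * ‖w - w'‖ ^ α) (v e : V) :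
    |f'' v e e| ≤ (4 * M / r ^ 2 + 2 * A * r ^ α) * ‖e‖ ^ 2 := by
  have key : ∀ e : V, ‖e‖ = r → |f'' v e e| ≤ 4 * M + 2 * A * r ^ α * r ^ 2 := by
    intro e he
    have hosc : ∀ e' : V, ‖e'‖ = r → ∀ s ∈ Icc (0 : ℝ) 1,
        |f'' (v + s • e') e' e' - f'' v e' e'| ≤ A * r ^ α * r ^ 2 := by
      intro e' he' s hs
      have h1 := (f'' (v + s • e') - f'' v).le_opNorm₂ e' e'
      rw [he'] at h1
      have h2 := hH (v + s • e') v
      have h3 : ‖v + s • e' - v‖ ≤ r := by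
        rw [add_sub_cancel_left, norm_smul, he', Real.norm_of_nonneg hs.1]
        exact mul_le_of_le_one_left hr.le hs.2
      have h4 : A * ‖v + s • e' - v‖ ^ α ≤ A * r ^ α := by gcongr
      have h5 : ‖f'' (v + s • e') - f'' v‖ * r * r ≤ A * r ^ α * r * r := by
        gcongr
        exact h2.trans h4
      calc |f'' (v + s • e') e' e' - f'' v e' e'|
          = ‖(f'' (v + s • e') - f'' v) e' e'‖ := by simp
        _ ≤ _ := h1
        _ ≤ _ := h5
        _ = _ := by ring
    have h1 := abs_taylor_two_sub_le hf hf' (hosc e he)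
    have h2 := abs_taylor_two_sub_le hf hf' (hosc (-e) (by rwa [norm_neg]))
    simp only [map_neg, _root_.neg_apply, neg_neg] at h2
    have h3 := hM v
    have h4 := hM (v + e)
    have h5 := hM (v + -e)
    rw [abs_le] at *
    constructor <;> linarith
  rcases eq_or_ne e 0 with rfl | he
  · simp
  have hpos : 0 < ‖e‖ := norm_pos_iff.2 he
  have h1 := key ((r / ‖e‖) • e) (by
    rw [norm_smul, Real.norm_of_nonneg (by positivity), div_mul_cancel₀ _ hpos.ne'])
  simp only [map_smul, FunLike.coe_smul, Pi.smul_apply, smul_eq_mul] at h1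
  rw [← mul_assoc, abs_mul, abs_of_pos (by positivity)] at h1
  have h2 : |f'' v e e| = (r / ‖e‖ * (r / ‖e‖) * |f'' v e e|) * (‖e‖ ^ 2 / r ^ 2) := by
    field_simp
  rw [h2]
  calc _ ≤ (4 * M + 2 * A * r ^ α * r ^ 2) * (‖e‖ ^ 2 / r ^ 2) := by gcongr
    _ = _ := by field_simp

end Taylor

section Seminorms

variable {d : ℕ} {F : Type*} [NormedAddCommGroup F]

theorem norm_le_toReal_supNorm {G : Set (Pt d)} {u : Pt d → F} (h : supNorm G u < ⊤) {z : Pt d}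
    (hz : z ∈ G) : ‖u z‖ ≤ (supNorm G u).toReal := by
  have h1 : ENNReal.ofReal ‖u z‖ ≤ supNorm G u := by
    rw [ofReal_norm]
    exact le_iSup₂_of_le (f := fun z (_ : z ∈ G) => (‖u z‖₊ : ℝ≥0∞)) z hz le_rfl
  exact (ENNReal.ofReal_le_iff_le_toReal h.ne).1 h1

theorem supNorm_lt_top {G : Set (Pt d)} {u : Pt d → F} {c : ℝ} (h : ∀ z ∈ G, ‖u z‖ ≤ c) :
    supNorm G u < ⊤ := by
  refine lt_of_le_of_lt (b := ENNReal.ofReal c) (iSup₂_le fun z hz => ?_) ENNReal.ofReal_lt_top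
  rw [← enorm_eq_nnnorm, ← ofReal_norm]
  exact ENNReal.ofReal_le_ofReal (h z hz)

theorem norm_sub_le_toReal_kSemi {α : ℝ} {G : Set (Pt d)} {u : Pt d → F} (h : kSemi α G u < ⊤)
    {z z' : Pt d} (hz : z ∈ G) (hz' : z' ∈ G) (hne : z ≠ z') (hρ : 0 < kRho z z') :
    ‖u z - u z'‖ ≤ (kSemi α G u).toReal * kRho z z' ^ α := by
  have h1 : ENNReal.ofReal (‖u z - u z'‖ / kRho z z' ^ α) ≤ kSemi α G u :=
    le_iSup_of_le z <| le_iSup_of_le hz <| le_iSup_of_le z' <| le_iSup_of_le hz' <|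
      le_iSup_of_le hne le_rfl
  exact (div_le_iff₀ (Real.rpow_pos_of_pos hρ α)).1 ((ENNReal.ofReal_le_iff_le_toReal h.ne).1 h1)

theorem norm_sub_le_toReal_lixvSemi {α : ℝ} (hα : α ≠ 0) {I : Set ℝ} {u : Pt d → F}
    (h : lixvSemi α I univ u < ⊤) {t : ℝ} (ht : t ∈ I) (x v v' : Ed d) :
    ‖u (t, x, v) - u (t, x, v')‖ ≤ (lixvSemi α I univ u).toReal * ‖v - v'‖ ^ α := by
  rcases eq_or_ne v v' with rfl | hv
  · simp [hα]
  have hpos : 0 < ‖v - v'‖ := norm_pos_iff.2 (sub_ne_zero.2 hv)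
  have h1 : ENNReal.ofReal (‖u (t, x, v) - u (t, x, v')‖ /
      (‖x - x‖ ^ ((1 : ℝ) / 3) + ‖v - v'‖) ^ α) ≤ lixvSemi α I univ u :=
    le_iSup_of_le t <| le_iSup_of_le ht <| le_iSup_of_le (x, v) <| le_iSup_of_le trivial <|
      le_iSup_of_le (x, v') <| le_iSup_of_le trivial <|
      le_iSup_of_le (fun h => hv (Prod.ext_iff.1 h).2) le_rfl
  rw [sub_self, norm_zero, Real.zero_rpow (by norm_num), zero_add] at h1
  exact (div_le_iff₀ (Real.rpow_pos_of_pos hpos α)).1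
    ((ENNReal.ofReal_le_iff_le_toReal h.ne).1 h1)

theorem lixvSemi_le_kSemi {α : ℝ} (hα : 0 ≤ α) (I : Set ℝ) (D : Set (Ed d × Ed d))
    (u : Pt d → F) : lixvSemi α I D u ≤ kSemi α (I ×ˢ D) u := by
  refine iSup₂_le fun t ht => iSup₂_le fun p hp => iSup₂_le fun q hq => iSup_le fun hpq => ?_
  refine le_iSup_of_le (t, p) <| le_iSup_of_le ⟨ht, hp⟩ <| le_iSup_of_le (t, q) <|
    le_iSup_of_le ⟨ht, hq⟩ <| le_iSup_of_le (fun h => hpq (Prod.ext_iff.1 h).2) <|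
    ENNReal.ofReal_le_ofReal ?_
  have hρ : kRho (t, p) (t, q) = max (‖p.1 - q.1‖ ^ ((1 : ℝ) / 3)) ‖p.2 - q.2‖ := by
    simp only [kRho, sub_self, abs_zero, zero_smul, add_zero]
    rw [Real.zero_rpow (by norm_num)]
    exact max_eq_right (le_max_of_le_right (norm_nonneg _))
  have h1 : 0 ≤ ‖p.1 - q.1‖ ^ ((1 : ℝ) / 3) := by positivity
  have hpos : 0 < kRho (t, p) (t, q) := by
    rw [hρ, lt_max_iff]
    by_contra! hcon
    refine hpq (Prod.ext ?_ ?_)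
    · by_contra hne
      exact absurd hcon.1 (not_le.2 (Real.rpow_pos_of_pos (norm_pos_iff.2 (sub_ne_zero.2 hne)) _))
    · exact sub_eq_zero.1 (norm_le_zero_iff.1 hcon.2)
  have hle : kRho (t, p) (t, q) ≤ ‖p.1 - q.1‖ ^ ((1 : ℝ) / 3) + ‖p.2 - q.2‖ := by
    rw [hρ]
    exact max_le (by linarith [norm_nonneg (p.2 - q.2)]) (by linarith)
  exact div_le_div_of_nonneg_left (norm_nonneg _) (Real.rpow_pos_of_pos hpos α)
    (Real.rpow_le_rpow hpos.le hle hα)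

theorem kSemi_le_ofReal {α c : ℝ} {G : Set (Pt d)} {u : Pt d → F}
    (h : ∀ z ∈ G, ∀ z' ∈ G, ‖u z - u z'‖ / kRho z z' ^ α ≤ c) :
    kSemi α G u ≤ ENNReal.ofReal c :=
  iSup₂_le fun z hz => iSup₂_le fun z' hz' => iSup_le fun _ =>
    ENNReal.ofReal_le_ofReal (h z hz z' hz')

theorem kRho_nonneg (z z' : Pt d) : 0 ≤ kRho z z' :=
  le_max_of_le_left (by positivity)

theorem abs_sub_fst_le_kRho_sq (z z' : Pt d) : |z.1 - z'.1| ≤ kRho z z' ^ 2 := by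
  have h1 : |z.1 - z'.1| ^ ((1 : ℝ) / 2) ≤ kRho z z' := le_max_left _ _
  calc |z.1 - z'.1| = (|z.1 - z'.1| ^ ((1 : ℝ) / 2)) ^ 2 := by
        rw [← Real.rpow_natCast, ← Real.rpow_mul (abs_nonneg _)]; norm_num
    _ ≤ _ := by gcongr

theorem norm_shift_le_kRho_cube (z z' : Pt d) :
    ‖z.2.1 - z'.2.1 + (z.1 - z'.1) • z'.2.2‖ ≤ kRho z z' ^ 3 := by
  set a := z.2.1 - z'.2.1 + (z.1 - z'.1) • z'.2.2 with ha
  have h1 : ‖a‖ ^ ((1 : ℝ) / 3) ≤ kRho z z' := le_max_of_le_right (le_max_left _ _)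
  calc ‖a‖ = (‖a‖ ^ ((1 : ℝ) / 3)) ^ 3 := by
        rw [← Real.rpow_natCast, ← Real.rpow_mul (norm_nonneg _)]; norm_num
    _ ≤ _ := by gcongr

theorem norm_sub_snd_le_kRho (z z' : Pt d) : ‖z.2.2 - z'.2.2‖ ≤ kRho z z' :=
  le_max_of_le_right (le_max_right _ _)

end Seminorms

section Membership

variable {d : ℕ} {u : Pt d → ℝ} {α : ℝ}

theorem continuousOn_flow {I : Set ℝ} (hα : 0 < α) (h : kSemi α (I ×ˢ univ) u < ⊤) (y v : Ed d) :
    ContinuousOn (fun s : ℝ => u (s, y - s • v, v)) I := by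
  intro s hs
  set C := (kSemi α (I ×ˢ (univ : Set (Ed d × Ed d))) u).toReal with hC
  have hbound : ∀ s' ∈ I, dist (u (s', y - s' • v, v)) (u (s, y - s • v, v)) ≤
      C * (|s' - s| ^ ((1 : ℝ) / 2)) ^ α := by
    intro s' hs'
    rcases eq_or_ne s' s with rfl | hne
    · rw [dist_self]; positivity
    have hρ : kRho (s', y - s' • v, v) (s, y - s • v, v) = |s' - s| ^ ((1 : ℝ) / 2) := by
      have h0 : y - s' • v - (y - s • v) + (s' - s) • v = 0 := by rw [sub_smul]; abel
      simp only [kRho, h0, sub_self, norm_zero]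
      rw [Real.zero_rpow (by norm_num), max_self]
      exact max_eq_left (by positivity)
    have h1 := norm_sub_le_toReal_kSemi h (z := (s', y - s' • v, v)) (z' := (s, y - s • v, v))
      ⟨hs', trivial⟩ ⟨hs, trivial⟩ (fun h => hne (Prod.ext_iff.1 h).1)
      (by rw [hρ]; exact Real.rpow_pos_of_pos (abs_pos.2 (sub_ne_zero.2 hne)) _)
    rwa [hρ] at h1
  have hlim : Tendsto (fun s' : ℝ => C * (|s' - s| ^ ((1 : ℝ) / 2)) ^ α) (𝓝[I] s) (𝓝 0) := by
    have hcont : Continuous fun s' : ℝ => C * (|s' - s| ^ ((1 : ℝ) / 2)) ^ α :=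
      continuous_const.mul (((continuous_id.sub continuous_const).abs.rpow_const
        fun _ => Or.inr (by norm_num)).rpow_const fun _ => Or.inr hα.le)
    have h0 := (hcont.tendsto s).mono_left (nhdsWithin_le_nhds (s := I))
    have hz : C * (|s - s| ^ ((1 : ℝ) / 2)) ^ α = 0 := by
      rw [sub_self, abs_zero, Real.zero_rpow (by norm_num), Real.zero_rpow hα.ne', mul_zero]
    rwa [hz] at h0
  exact tendsto_iff_dist_tendsto_zero.2 (squeeze_zero' (Eventually.of_forall fun _ => dist_nonneg)
    (eventually_nhdsWithin_of_forall hbound) hlim)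

/-- A bound on the pointwise transport derivative gives a Lipschitz bound along the flow. -/
theorem abs_flow_sub_le {I : Set ℝ} (hI : I.OrdConnected) {K : ℝ}
    (hc : ∀ y v : Ed d, ContinuousOn (fun s : ℝ => u (s, y - s • v, v)) I)
    (ht : ∀ z ∈ I ×ˢ (univ : Set (Ed d × Ed d)),
      DifferentiableAt ℝ (fun s => u (s, z.2.1, z.2.2)) z.1)
    (hx : ∀ z ∈ I ×ˢ (univ : Set (Ed d × Ed d)),
      DifferentiableAt ℝ (fun y => u (z.1, y, z.2.2)) z.2.1)
    (hK : ∀ z ∈ I ×ˢ (univ : Set (Ed d × Ed d)), |Yop u z| ≤ K)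
    {a b : ℝ} (ha : a ∈ I) (hb : b ∈ I) (hab : a ≤ b) (y v : Ed d) :
    |u (b, y - b • v, v) - u (a, y - a • v, v)| ≤ K * (b - a) := by
  have hsub : Icc a b ⊆ I := hI.out ha hb
  have hmem : ∀ s ∈ Ico a b, (s, y - s • v, v) ∈ I ×ˢ (univ : Set (Ed d × Ed d)) := fun s hs =>
    ⟨hsub (Ico_subset_Icc_self hs), trivial⟩
  have hp : ∀ s ∈ Ico a b, HasDerivAt (fun t => u (t, y - s • v, v))
      (Dt u (s, y - s • v, v)) s := fun s hs => (ht _ (hmem s hs)).hasDerivAt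
  have hq : ∀ s ∈ Ico a b, HasDerivAt (fun r : ℝ => u (s, y - r • v, v))
      (-Dx u (s, y - s • v, v) v) s := by
    intro s hs
    have hline : HasDerivAt (fun r : ℝ => y - r • v) (-v) s := by
      simpa using ((hasDerivAt_id s).smul_const v).const_sub y
    have hcomp := (hx _ (hmem s hs)).hasFDerivAt.comp_hasDerivAt s hline
    rw [map_neg] at hcomp
    exact hcomp
  have h1 := diag_sub_le_of_hasDerivAt (h := fun t s => u (t, y - s • v, v)) (K := K) hab
    ((hc y v).mono hsub) hp hq (fun s hs => by
      have := (abs_le.1 (hK _ (hmem s hs))).2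
      simp only [Yop] at this
      linarith)
  have h2 := diag_sub_le_of_hasDerivAt (h := fun t s => -u (t, y - s • v, v)) (K := K) hab
    ((hc y v).mono hsub).neg (fun s hs => (hp s hs).neg) (fun s hs => (hq s hs).neg)
    (fun s hs => by
      have := (abs_le.1 (hK _ (hmem s hs))).1
      simp only [Yop] at this
      linarith)
  exact abs_le.2 ⟨by linarith, h1⟩

theorem kC2mem.kineticBounds {T : EReal} (hα : 0 < α) (hu : kC2mem α (slabI T) univ u)
    {ε : ℝ} (hε : 0 < ε) :
    KineticBounds (slabI T) u (supNorm (slabG d T) u).toReal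
      (supNorm (slabG d T) (Yop u)).toReal
      (4 * (supNorm (slabG d T) u).toReal / ε ^ 2 +
        2 * (lixvSemi α (slabI T) univ (Dvv u)).toReal * ε ^ α) := by
  obtain ⟨hM, hS, ht, hx, hv, hvv, hK, -, hA⟩ := hu
  have hA' := (lixvSemi_le_kSemi hα.le _ _ _).trans_lt hA
  have hsub : ∀ t ∈ slabI T, ∀ s : ℝ, 0 ≤ s → t - s ∈ slabI T := fun t ht s hs =>
    lt_of_le_of_lt (EReal.coe_le_coe_iff.2 (by linarith)) ht
  have hI : (slabI T).OrdConnected := ⟨fun a _ b hb s hs =>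
    lt_of_le_of_lt (EReal.coe_le_coe_iff.2 hs.2) hb⟩
  have hle : ∀ a ∈ slabI T, ∀ b ∈ slabI T, a ≤ b → ∀ y v : Ed d,
      |u (b, y - b • v, v) - u (a, y - a • v, v)| ≤
        (supNorm (slabG d T) (Yop u)).toReal * (b - a) := fun a ha b hb hab y v =>
    abs_flow_sub_le hI (continuousOn_flow hα hS) ht hx
      (fun z hz => norm_le_toReal_supNorm hK hz) ha hb hab y v
  refine ⟨ENNReal.toReal_nonneg, by positivity, hsub,
    fun t ht x v => norm_le_toReal_supNorm hM (z := (t, x, v)) ⟨ht, trivial⟩, ?_, ?_⟩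
  · intro t ht t' ht' x v
    have h1 : x - (t - t') • v = (x + t' • v) - t • v := by rw [sub_smul]; abel
    have h2 : x = (x + t' • v) - t' • v := by abel
    rw [h1]
    nth_rewrite 2 [h2]
    rcases le_total t' t with h | h
    · rw [abs_of_nonneg (sub_nonneg.2 h)]
      exact hle t' ht' t ht h _ v
    · rw [abs_sub_comm, abs_sub_comm t, abs_of_nonneg (sub_nonneg.2 h)]
      exact hle t ht t' ht' h _ v
  · intro t ht x v e
    have hf : ∀ w, HasFDerivAt (fun w => u (t, x, w)) (Dv u (t, x, w)) w := fun w =>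
      (hv (t, x, w) ⟨ht, trivial⟩).hasFDerivAt
    have hf' : ∀ w, HasFDerivAt (fun w => Dv u (t, x, w)) (Dvv u (t, x, w)) w := fun w =>
      (hvv (t, x, w) ⟨ht, trivial⟩).hasFDerivAt
    have hquad := abs_hessian_apply_le hf hf' hα.le ENNReal.toReal_nonneg hε
      (fun w => norm_le_toReal_supNorm hM (z := (t, x, w)) ⟨ht, trivial⟩)
      (fun w w' => norm_sub_le_toReal_lixvSemi hα.ne' hA' ht x w w')
    have := abs_taylor_two_sub_le hf hf' (v := v) (e := e) (q := 0)
      (fun s _ => by rw [sub_zero]; exact hquad (v + s • e) e)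
    rw [_root_.zero_div, _root_.sub_zero] at this
    exact this

end Membership

section Interpolation

theorem div_rpow_le_of_le {D c r ε α : ℝ} (hα0 : 0 < α) (hα1 : α < 1) (hr : 0 ≤ r) (hc : 0 ≤ c)
    (hrε : r ≤ ε) (hD : 0 < r → D ≤ c * r) : D / r ^ α ≤ c * ε ^ (1 - α) := by
  rcases hr.eq_or_lt with rfl | hr'
  · rw [Real.zero_rpow hα0.ne', _root_.div_zero]; positivity
  rw [div_le_iff₀ (Real.rpow_pos_of_pos hr' α)]
  calc D ≤ c * r := hD hr'
    _ = c * r ^ (1 - α) * r ^ α := by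
        rw [mul_assoc, ← Real.rpow_add hr', sub_add_cancel, Real.rpow_one]
    _ ≤ c * ε ^ (1 - α) * r ^ α := by
        have : 0 ≤ 1 - α := by linarith
        gcongr

theorem div_rpow_le_of_ge {D c r ε α : ℝ} (hα0 : 0 < α) (hε : 0 < ε) (hc : 0 ≤ c)
    (hrε : ε ≤ r) (hD : D ≤ c) : D / r ^ α ≤ c * ε ^ (-α) := by
  rw [Real.rpow_neg hε.le, ← div_eq_mul_inv]
  gcongr

variable {d : ℕ} {I : Set ℝ} {u : Pt d → ℝ} {M K L : ℝ}

theorem KineticBounds.abs_sub_le (h : KineticBounds I u M K L) {r ε : ℝ} (hr : 0 < r)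
    (hrε : r ≤ ε) {z z' : Pt d} (hz : z.1 ∈ I) (hz' : z'.1 ∈ I) (hρ : kRho z z' = r) :
    |u z - u z'| ≤ (L * ε + 2 * M / ε + (2 * L + 65 * (K + L)) * ε) * r := by
  obtain ⟨t, x, v⟩ := z
  obtain ⟨t', x', v'⟩ := z'
  have hε : 0 < ε := hr.trans_le hrε
  have hL := h.L_nonneg
  have hK := h.K_nonneg
  have h1 := h.taylor t hz x v' (v - v')
  have h2 := h.norm_Dv_le hz hε x v'
  have hv : ‖v - v'‖ ≤ r := hρ ▸ norm_sub_snd_le_kRho (t, x, v) (t', x', v')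
  have hx : ‖x - x' + (t - t') • v'‖ ≤ r ^ 3 :=
    hρ ▸ norm_shift_le_kRho_cube (t, x, v) (t', x', v')
  have ht : |t - t'| ≤ r ^ 2 := hρ ▸ abs_sub_fst_le_kRho_sq (t, x, v) (t', x', v')
  have h3 := h.diff_tx hz hz' hr x x' v' hx ht
  have h4 : |Dv u (t, x, v') (v - v')| ≤ (L * ε + 2 * M / ε) * r := by
    refine ((Dv u (t, x, v')).le_opNorm _).trans ?_
    have := (norm_nonneg _).trans h2
    gcongr
  have h5 : L * ‖v - v'‖ ^ 2 ≤ L * r ^ 2 := by gcongr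
  have h6 : r ^ 2 ≤ ε * r := by nlinarith
  have h7 : L * r ^ 2 ≤ L * (ε * r) := by gcongr
  have h8 : K * r ^ 2 ≤ K * (ε * r) := by gcongr
  rw [add_sub_cancel] at h1
  rw [_root_.abs_le] at *
  constructor <;> nlinarith

theorem KineticBounds.norm_Dv_sub_le (h : KineticBounds I u M K L) {r : ℝ} (hr : 0 < r)
    {z z' : Pt d} (hz : z.1 ∈ I) (hz' : z'.1 ∈ I) (hρ : kRho z z' = r) :
    ‖Dv u z - Dv u z'‖ ≤ 186 * (K + L) * r := by
  obtain ⟨t, x, v⟩ := z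
  obtain ⟨t', x', v'⟩ := z'
  have hK := h.K_nonneg
  have hv : ‖v - v'‖ ≤ r := hρ ▸ norm_sub_snd_le_kRho (t, x, v) (t', x', v')
  have hx : ‖x - x' + (t - t') • v'‖ ≤ r ^ 3 :=
    hρ ▸ norm_shift_le_kRho_cube (t, x, v) (t', x', v')
  have ht : |t - t'| ≤ r ^ 2 := hρ ▸ abs_sub_fst_le_kRho_sq (t, x, v) (t', x', v')
  have h1 := h.norm_Dv_sub_v hz hr x v v' hv
  have h2 := h.norm_Dv_sub_tx hz hz' hr x x' v' hx ht
  have h3 := norm_sub_le_norm_sub_add_norm_sub (Dv u (t, x, v)) (Dv u (t, x, v'))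
    (Dv u (t', x', v'))
  nlinarith

theorem KineticBounds.holder_le {α A ε : ℝ} (hα0 : 0 < α) (hα1 : α < 1) (hε : 0 < ε) (hM : 0 ≤ M)
    (hA : 0 ≤ A) (h : KineticBounds I u M K (4 * M / ε ^ 2 + 2 * A * ε ^ α)) {z z' : Pt d}
    (hz : z.1 ∈ I) (hz' : z'.1 ∈ I) :
    ‖u z - u z'‖ / kRho z z' ^ α ≤
      1000 * ε ^ 2 * A + 1000 * ε ^ (2 - α) * K + 1000 * ε ^ (-α) * M := by
  set L := 4 * M / ε ^ 2 + 2 * A * ε ^ α with hL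
  have hK := h.K_nonneg
  have hL0 := h.L_nonneg
  have hP : 0 < ε ^ (-α) := Real.rpow_pos_of_pos hε _
  have hEP : ε ^ α * ε ^ (-α) = 1 := by rw [← Real.rpow_add hε, add_neg_cancel, Real.rpow_zero]
  have hP1 : ε ^ (1 - α) = ε * ε ^ (-α) := by
    rw [sub_eq_add_neg, Real.rpow_add hε, Real.rpow_one]
  have hP2 : ε ^ (2 - α) = ε ^ 2 * ε ^ (-α) := by
    rw [sub_eq_add_neg, Real.rpow_add hε, Real.rpow_two]
  have hLP : ε ^ 2 * ε ^ (-α) * L = 4 * M * ε ^ (-α) + 2 * A * ε ^ 2 := by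
    rw [hL]
    calc _ = 4 * M * ε ^ (-α) + 2 * A * ε ^ 2 * (ε ^ α * ε ^ (-α)) := by field_simp
      _ = _ := by rw [hEP, mul_one]
  have hKP : 0 ≤ ε ^ 2 * ε ^ (-α) * K := by positivity
  have hMP : 0 ≤ M * ε ^ (-α) := by positivity
  have hAε : 0 ≤ A * ε ^ 2 := by positivity
  rw [hP2]
  rcases le_total (kRho z z') ε with hr | hr
  · refine (div_rpow_le_of_le hα0 hα1 (kRho_nonneg z z') ?_ hr
      fun hr0 => h.abs_sub_le hr0 hr hz hz' rfl).trans ?_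
    · positivity
    · rw [hP1]
      have : (L * ε + 2 * M / ε + (2 * L + 65 * (K + L)) * ε) * (ε * ε ^ (-α)) =
          68 * (ε ^ 2 * ε ^ (-α) * L) + 65 * (ε ^ 2 * ε ^ (-α) * K) + 2 * (M * ε ^ (-α)) := by
        field_simp
        ring
      rw [this, hLP]
      linarith
  · refine (div_rpow_le_of_ge (c := 2 * M) hα0 hε (by positivity) hr ?_).trans ?_
    · refine (norm_sub_le _ _).trans ?_
      have h1 := h.abs_le _ hz z.2.1 z.2.2
      have h2 := h.abs_le _ hz' z'.2.1 z'.2.2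
      rw [Real.norm_eq_abs, Real.norm_eq_abs, two_mul]
      exact add_le_add h1 h2
    · linarith

theorem KineticBounds.holder_Dv_le {α A ε : ℝ} (hα0 : 0 < α) (hα1 : α < 1) (hε : 0 < ε)
    (hM : 0 ≤ M) (hA : 0 ≤ A) (h : KineticBounds I u M K (4 * M / ε ^ 2 + 2 * A * ε ^ α))
    {z z' : Pt d} (hz : z.1 ∈ I) (hz' : z'.1 ∈ I) :
    ‖Dv u z - Dv u z'‖ / kRho z z' ^ α ≤
      1000 * ε * A + 1000 * ε ^ (1 - α) * K + 1000 * ε ^ (-1 - α) * M := by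
  set L := 4 * M / ε ^ 2 + 2 * A * ε ^ α with hL
  have hK := h.K_nonneg
  have hL0 := h.L_nonneg
  have hP : 0 < ε ^ (-α) := Real.rpow_pos_of_pos hε _
  have hEP : ε ^ α * ε ^ (-α) = 1 := by rw [← Real.rpow_add hε, add_neg_cancel, Real.rpow_zero]
  have hP1 : ε ^ (1 - α) = ε * ε ^ (-α) := by
    rw [sub_eq_add_neg, Real.rpow_add hε, Real.rpow_one]
  have hP2 : ε ^ (-1 - α) = ε ^ (-α) / ε := by
    rw [sub_eq_add_neg, Real.rpow_add hε, Real.rpow_neg_one, inv_mul_eq_div]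
  have hLP : ε * ε ^ (-α) * L = 4 * (ε ^ (-α) / ε * M) + 2 * A * ε := by
    rw [hL]
    calc _ = 4 * (ε ^ (-α) / ε * M) + 2 * A * ε * (ε ^ α * ε ^ (-α)) := by field_simp
      _ = _ := by rw [hEP, mul_one]
  have hKP : 0 ≤ ε * ε ^ (-α) * K := by positivity
  have hMP : 0 ≤ ε ^ (-α) / ε * M := by positivity
  have hAε : 0 ≤ A * ε := by positivity
  rw [hP2]
  rcases le_total (kRho z z') ε with hr | hr
  · refine (div_rpow_le_of_le hα0 hα1 (kRho_nonneg z z') ?_ hr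
      fun hr0 => h.norm_Dv_sub_le hr0 hz hz' rfl).trans ?_
    · positivity
    · rw [hP1]
      linarith
  · refine (div_rpow_le_of_ge (c := 2 * (L * ε + 2 * M / ε)) hα0 hε (by positivity) hr ?_).trans ?_
    · refine (norm_sub_le _ _).trans ?_
      have h1 := h.norm_Dv_le hz hε z.2.1 z.2.2
      have h2 := h.norm_Dv_le hz' hε z'.2.1 z'.2.2
      rw [two_mul]
      exact add_le_add h1 h2
    · have : 2 * (L * ε + 2 * M / ε) * ε ^ (-α) =
          2 * (ε * ε ^ (-α) * L) + 4 * (ε ^ (-α) / ε * M) := by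
        field_simp
        ring
      rw [this, hLP, hP1]
      linarith

theorem ofReal_add_mul_toReal_le {a b c : ℝ} (ha : 0 ≤ a) (hb : 0 ≤ b) (hc : 0 ≤ c)
    {A K M : ℝ≥0∞} (B : ℝ≥0∞) (hA : A < ⊤) (hK : K < ⊤) (hM : M < ⊤) :
    ENNReal.ofReal (a * A.toReal + b * K.toReal + c * M.toReal) ≤
      ENNReal.ofReal a * (B + A) + ENNReal.ofReal b * K + ENNReal.ofReal c * M := by
  rw [ENNReal.ofReal_add (by positivity) (by positivity),
    ENNReal.ofReal_add (by positivity) (by positivity), ENNReal.ofReal_mul ha,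
    ENNReal.ofReal_mul hb, ENNReal.ofReal_mul hc, ENNReal.ofReal_toReal hA.ne,
    ENNReal.ofReal_toReal hK.ne, ENNReal.ofReal_toReal hM.ne]
  gcongr
  exact le_add_self

end Interpolation

end KineticInterpolation

open MeasureTheory ENNReal Set in
/-- **Corollary 1.6**: kinetic interpolation inequalities. -/
theorem kinetic_interpolation (d : ℕ) (hd : 1 ≤ d) (α : ℝ) (hα : α ∈ Set.Ioo (0:ℝ) 1) :
    ∃ N : ℝ, 0 < N ∧
      ∀ T : EReal, ⊥ < T → ∀ u : Pt d → ℝ, kC2mem α (slabI T) Set.univ u →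
        (supNorm (slabG d T) (Dv u) < ⊤ ∧ kSemi α (slabG d T) (Dv u) < ⊤) ∧
        ∀ ε : ℝ, 0 < ε →
          (kSemi α (slabG d T) u ≤
            ENNReal.ofReal (N * ε ^ 2) *
              (lixvSemi α (slabI T) Set.univ (Yop u) + lixvSemi α (slabI T) Set.univ (Dvv u))
            + ENNReal.ofReal (N * ε ^ (2 - α)) * supNorm (slabG d T) (Yop u)
            + ENNReal.ofReal (N * ε ^ (-α)) * supNorm (slabG d T) u) ∧
          (kSemi α (slabG d T) (Dv u) ≤
            ENNReal.ofReal (N * ε) *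
              (lixvSemi α (slabI T) Set.univ (Yop u) + lixvSemi α (slabI T) Set.univ (Dvv u))
            + ENNReal.ofReal (N * ε ^ (1 - α)) * supNorm (slabG d T) (Yop u)
            + ENNReal.ofReal (N * ε ^ (-1 - α)) * supNorm (slabG d T) u) := by
  obtain ⟨hα0, hα1⟩ := hα
  refine ⟨1000, by norm_num, fun T _ u hu => ?_⟩
  have hM : supNorm (slabG d T) u < ⊤ := hu.1
  have hK : supNorm (slabG d T) (Yop u) < ⊤ := hu.2.2.2.2.2.2.1
  have hB : lixvSemi α (slabI T) Set.univ (Yop u) < ⊤ := hu.2.2.2.2.2.2.2.1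
  have hA : lixvSemi α (slabI T) Set.univ (Dvv u) < ⊤ :=
    (lixvSemi_le_kSemi hα0.le _ _ _).trans_lt hu.2.2.2.2.2.2.2.2
  have hDv : ∀ ε : ℝ, 0 < ε → kSemi α (slabG d T) (Dv u) ≤
      ENNReal.ofReal (1000 * ε) *
        (lixvSemi α (slabI T) Set.univ (Yop u) + lixvSemi α (slabI T) Set.univ (Dvv u))
      + ENNReal.ofReal (1000 * ε ^ (1 - α)) * supNorm (slabG d T) (Yop u)
      + ENNReal.ofReal (1000 * ε ^ (-1 - α)) * supNorm (slabG d T) u := fun ε hε =>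
    (kSemi_le_ofReal fun z hz z' hz' => (hu.kineticBounds hα0 hε).holder_Dv_le hα0 hα1 hε
      ENNReal.toReal_nonneg ENNReal.toReal_nonneg hz.1 hz'.1).trans
      (ofReal_add_mul_toReal_le (by positivity) (by positivity) (by positivity) _ hA hK hM)
  refine ⟨⟨?_, (hDv 1 one_pos).trans_lt ?_⟩, fun ε hε => ⟨?_, hDv ε hε⟩⟩
  · exact supNorm_lt_top fun z hz =>
      (hu.kineticBounds hα0 one_pos).norm_Dv_le hz.1 one_pos z.2.1 z.2.2
  · exact ENNReal.add_lt_top.2 ⟨ENNReal.add_lt_top.2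
      ⟨ENNReal.mul_lt_top ENNReal.ofReal_lt_top (ENNReal.add_lt_top.2 ⟨hB, hA⟩),
        ENNReal.mul_lt_top ENNReal.ofReal_lt_top hK⟩,
      ENNReal.mul_lt_top ENNReal.ofReal_lt_top hM⟩
  · exact (kSemi_le_ofReal fun z hz z' hz' => (hu.kineticBounds hα0 hε).holder_le hα0 hα1 hε
      ENNReal.toReal_nonneg ENNReal.toReal_nonneg hz.1 hz'.1).trans
      (ofReal_add_mul_toReal_le (by positivity) (by positivity) (by positivity) _ hA hK hM)
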